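/- Let N ≥ 2 and 1 ≤ M < N be integers, P_I, P_f, P_m ∈ (0,1), C_p > 0, and suppose: (i) a := P_I(1−P_f)^N·(1/N) − (1−P_I)P_m^N·C_p > 0; (ii) the post-punishment per-attacker reward is positive, i.e. c := P_I(1−P_f)^M − M(1−P_I)P_m^M·C_p > 0; and (iii) a > P_I(1−P_f)^M·(1/M) − (1−P_I)P_m^M·C_p. Define LR^H = (M/(1−δ))·a, LR_{SC}^{DH} = ( P_I(1−P_f)^N − M(1−P_I)P_m^N·C_p )/(1 − δ(1 − (1−P_I)P_m^N)) + (δ/(1−δ))·(1−P_I)P_m^N·c/(1 − δ(1 − (1−P_I)P_m^N)), and δ^{th}_{SC}(M) = ( 1 + ( ( (P_I(1−P_f)^N·(1/N) − (1−P_I)P_m^N·C_p) − (P_I(1−P_f)^M·(1/M) − (1−P_I)P_m^M·C_p) ) / (1/M − 1/N) )·((1−P_I)/P_I)·(P_m/(1−P_f))^N )^{−1}. Then for every δ with δ^{th}_{SC}(M) < δ < 1, we have LR_{SC}^{DH} < LR^H; i.e., in the strong-cooperation case, the indirect punishment makes honest behavior strictly better for the attackers whenever the discount factor exceeds δ^{th}_{SC}(M).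 -/

import Mathlib

/-- Here `A` is the probability that the channel is idle and reported idle by everyone, `q` that of
a collision while everyone reports idle, `b` the per-attacker reward per slot after the punishment, and
`x = 1 / N`. -/
theorem attack_reward_lt_honest_reward {m x A q C b δ : ℝ}
    (hm : 0 < m) (hx : 0 < 1 / m - x) (hA : 0 < A) (hq : 0 < q)
    (hb : b < A * x - q * C) (hδ1 : δ < 1)
    (hδ : (1 + (A * x - q * C - b) / (1 / m - x) * (q / A))⁻¹ < δ) :
    (A - m * q * C) / (1 - δ * (1 - q)) + δ / (1 - δ) * q * (m * b) / (1 - δ * (1 - q)) <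
      m / (1 - δ) * (A * x - q * C) := by
  set k := (A * x - q * C - b) / (1 / m - x) * (q / A) with hk
  have hk0 : 0 < k := mul_pos (div_pos (sub_pos.2 hb) hx) (div_pos hq hA)
  have hδ0 : 0 < δ := lt_trans (by positivity) hδ
  have hthreshold : 1 - δ < δ * k := by
    have := (inv_lt_iff_one_lt_mul₀ (by positivity)).1 hδ
    linarith
  have hkA : k * (A * (1 / m - x)) = q * (A * x - q * C - b) := by
    rw [hk, div_mul_div_comm, mul_comm A (1 / m - x), div_mul_cancel₀ _ (mul_pos hx hA).ne', mul_comm]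
  have hgain : (1 - δ) * (A * (1 / m - x)) < δ * (q * (A * x - q * C - b)) := by
    rw [← hkA, ← mul_assoc δ]
    exact mul_lt_mul_of_pos_right hthreshold (mul_pos hA hx)
  have hgain' : (1 - δ) * (A * (1 - m * x)) < m * (δ * (q * (A * x - q * C - b))) := by
    have h := mul_lt_mul_of_pos_left hgain hm
    have hm1 : m * ((1 - δ) * (A * (1 / m - x))) = (1 - δ) * (A * (1 - m * x)) := by
      field_simp
    rwa [hm1] at h
  have hδ' : 0 < 1 - δ := sub_pos.2 hδ1
  have hD : 0 < 1 - δ * (1 - q) := by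
    linarith [mul_pos hδ0 hq]
  have hlhs : (A - m * q * C) / (1 - δ * (1 - q)) +
      δ / (1 - δ) * q * (m * b) / (1 - δ * (1 - q)) =
      ((1 - δ) * (A - m * q * C) + δ * q * (m * b)) / ((1 - δ) * (1 - δ * (1 - q))) := by
    field_simp
  rw [hlhs, div_mul_eq_mul_div, div_lt_div_iff₀ (mul_pos hδ' hD) hδ']
  have h := mul_lt_mul_of_pos_left hgain' hδ'
  linarith


theorem indirect_punishment_strong_cooperation
    (N M : ℕ) (hN : 2 ≤ N) (hM1 : 1 ≤ M) (hMN : M < N)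
    (PI Pf Pm Cp δ : ℝ)
    (hPI0 : 0 < PI) (hPI1 : PI < 1)
    (hPf0 : 0 < Pf) (hPf1 : Pf < 1)
    (hPm0 : 0 < Pm) (hPm1 : Pm < 1)
    (hCp : 0 < Cp)
    (ha : 0 < PI * (1 - Pf) ^ N * (1 / N) - (1 - PI) * Pm ^ N * Cp)
    (hc : 0 < PI * (1 - Pf) ^ M - M * (1 - PI) * Pm ^ M * Cp)
    (hac : PI * (1 - Pf) ^ N * (1 / N) - (1 - PI) * Pm ^ N * Cp >
      PI * (1 - Pf) ^ M * (1 / M) - (1 - PI) * Pm ^ M * Cp)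
    (hδ1 : δ < 1)
    (hδth : (1 + ((PI * (1 - Pf) ^ N * (1 / N) - (1 - PI) * Pm ^ N * Cp) -
          (PI * (1 - Pf) ^ M * (1 / M) - (1 - PI) * Pm ^ M * Cp)) /
        ((1 : ℝ) / M - 1 / N) * ((1 - PI) / PI) * (Pm / (1 - Pf)) ^ N)⁻¹ < δ) :
    (PI * (1 - Pf) ^ N - M * (1 - PI) * Pm ^ N * Cp) /
        (1 - δ * (1 - (1 - PI) * Pm ^ N)) +
      (δ / (1 - δ)) * (1 - PI) * Pm ^ N *
        (PI * (1 - Pf) ^ M - M * (1 - PI) * Pm ^ M * Cp) /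
        (1 - δ * (1 - (1 - PI) * Pm ^ N)) <
      (M / (1 - δ)) * (PI * (1 - Pf) ^ N * (1 / N) - (1 - PI) * Pm ^ N * Cp) := by
  have hM : (0 : ℝ) < M := by exact_mod_cast hM1
  have hMN' : (M : ℝ) < N := by exact_mod_cast hMN
  have hw : 0 < (1 : ℝ) / M - 1 / N := sub_pos.2 (one_div_lt_one_div_of_lt hM hMN')
  have hA : 0 < PI * (1 - Pf) ^ N := mul_pos hPI0 (pow_pos (sub_pos.2 hPf1) N)
  have hq : 0 < (1 - PI) * Pm ^ N := mul_pos (sub_pos.2 hPI1) (pow_pos hPm0 N)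
  have hratio : (1 - PI) / PI * (Pm / (1 - Pf)) ^ N =
      (1 - PI) * Pm ^ N / (PI * (1 - Pf) ^ N) := by
    rw [div_pow, div_mul_div_comm]
  have hc' : PI * (1 - Pf) ^ M - M * (1 - PI) * Pm ^ M * Cp =
      M * (PI * (1 - Pf) ^ M * (1 / M) - (1 - PI) * Pm ^ M * Cp) := by
    field_simp
  rw [mul_assoc (_ / _) (_ / PI), hratio] at hδth
  rw [hc', mul_assoc (δ / (1 - δ)), mul_assoc (M : ℝ) (1 - PI)]
  exact attack_reward_lt_honest_reward hM hw hA hq hac hδ1 hδth
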